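/- arXiv:2412.00844 — 11 statements merged into one kernel-verified Lean document; each statement's English description precedes it below -/
import Mathlib

section
/- For every n ≥ 1 and every x ∈ ℂ, the derivative of the 2-variable general-λ-matrix polynomial satisfies (d/dx) _Gλ_n^R(x) = n · _Gλ_{n-1}^R(x). -/
/-- The coefficients `c_R(j) = Γ(R+j+1)/Γ(2R+2j+1)` (scalar instance of the matrix parameter). -/
noncomputable def cR (R : ℂ) (j : ℕ) : ℂ :=
  Complex.Gamma (R + j + 1) / Complex.Gamma (2 * R + 2 * j + 1)

/-- The 2-variable general polynomials `p_n(x) = Σ_{k=0}^n (n choose k) φ_k x^{n-k}`. -/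
noncomputable def genPoly (φ : ℕ → ℂ) (n : ℕ) (x : ℂ) : ℂ :=
  ∑ k ∈ Finset.range (n + 1), (n.choose k : ℂ) * φ k * x ^ (n - k)

/-- The 2-variable general-λ-matrix polynomials
`_Glam_n^R(x) = Σ_{j=0}^n (n choose j) (-1)^j c_R(j) p_{n-j}(x)`. -/
noncomputable def Glam (R : ℂ) (φ : ℕ → ℂ) (n : ℕ) (x : ℂ) : ℂ :=
  ∑ j ∈ Finset.range (n + 1), (n.choose j : ℂ) * (-1) ^ j * cR R j * genPoly φ (n - j) x

theorem appell_aux (a : ℕ → ℂ) (f : ℕ → ℂ → ℂ) (x : ℂ)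
    (hf : ∀ m : ℕ, HasDerivAt (f m) ((m : ℂ) * f (m - 1) x) x) (n : ℕ) :
    HasDerivAt (fun u => ∑ j ∈ Finset.range (n + 1), (n.choose j : ℂ) * a j * f (n - j) u)
      ((n : ℂ) * ∑ j ∈ Finset.range (n - 1 + 1),
        ((n - 1).choose j : ℂ) * a j * f (n - 1 - j) x) x := by
  have h := HasDerivAt.fun_sum (u := Finset.range (n + 1)) (x := x)
    (fun j _ => (hf (n - j)).const_mul ((n.choose j : ℂ) * a j))
  refine h.congr_deriv ?_
  cases n with
  | zero => simp
  | succ m =>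
    rw [Finset.sum_range_succ, Finset.mul_sum]
    simp only [Nat.sub_self, Nat.cast_zero, zero_mul, mul_zero, add_zero, Nat.add_sub_cancel]
    refine Finset.sum_congr rfl fun j hj => ?_
    have hc : ((m.choose j : ℕ) : ℂ) * ((m + 1 : ℕ) : ℂ)
        = ((m + 1).choose j : ℂ) * ((m + 1 - j : ℕ) : ℂ) := by
      exact_mod_cast Nat.choose_mul_succ_eq m j
    have e : m + 1 - j - 1 = m - j := by omega
    rw [e]
    linear_combination (-(a j * f (m - j) x)) * hc

/-- Differential recurrence relation: `(d/dx) _Glam_n^R(x) = n · _Glam_{n-1}^R(x)` for `n ≥ 1`. -/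
theorem deriv_Glam (R : ℂ) (hR : 0 < R.re) (φ : ℕ → ℂ) (n : ℕ) (hn : 1 ≤ n) (x : ℂ) :
    deriv (fun u => Glam R φ n u) x = (n : ℂ) * Glam R φ (n - 1) x := by
  have hg : ∀ m : ℕ, HasDerivAt (genPoly φ m) ((m : ℂ) * genPoly φ (m - 1) x) x := fun m =>
    appell_aux φ (fun k u => u ^ k) x (fun k => hasDerivAt_pow k x) m
  have h := appell_aux (fun j => (-1) ^ j * cR R j) (genPoly φ) x hg n
  simp only [← mul_assoc] at h
  simp only [Glam]
  rw [h.deriv]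
end

section
/- For all natural numbers j ≤ n and every x ∈ ℂ, the j-th iterated derivative of the 2-variable general-λ-matrix polynomial satisfies (d/dx)^j _Gλ_n^R(x) = (n!/(n-j)!) · _Gλ_{n-j}^R(x). -/
/-- Appell step: binomial convolution preserves the Appell property. -/
theorem appell_conv (f : ℕ → ℂ → ℂ) (a : ℕ → ℂ)
    (h0 : ∀ x, HasDerivAt (f 0) 0 x)
    (hf : ∀ n x, HasDerivAt (f (n + 1)) (((n : ℂ) + 1) * f n x) x) (n : ℕ) (x : ℂ) :
    HasDerivAt (fun u => ∑ k ∈ Finset.range (n + 1 + 1), ((n + 1).choose k : ℂ) * a k * f (n + 1 - k) u)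
      (((n : ℂ) + 1) * ∑ k ∈ Finset.range (n + 1), (n.choose k : ℂ) * a k * f (n - k) x) x := by
  have h : HasDerivAt
      (fun u => ∑ k ∈ Finset.range (n + 1 + 1), ((n + 1).choose k : ℂ) * a k * f (n + 1 - k) u)
      (∑ k ∈ Finset.range (n + 1 + 1), ((n + 1).choose k : ℂ) * a k *
        (((n + 1 - k : ℕ) : ℂ) * f (n - k) x)) x := by
    apply HasDerivAt.fun_sum
    intro k hk
    apply HasDerivAt.const_mul
    rcases Nat.lt_or_ge n k with h | h
    · have e : n + 1 - k = 0 := by omega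
      rw [e]
      simpa using h0 x
    · have e : n + 1 - k = (n - k) + 1 := by omega
      rw [e]
      simpa using hf (n - k) x
  convert h using 1
  rw [Finset.sum_range_succ _ (n + 1), Finset.mul_sum]
  simp only [Nat.sub_self, Nat.cast_zero, zero_mul, mul_zero, add_zero]
  apply Finset.sum_congr rfl
  intro k hk
  have e : (n.choose k : ℂ) * ((n : ℂ) + 1) = ((n + 1).choose k : ℂ) * ((n + 1 - k : ℕ) : ℂ) := by
    exact_mod_cast Nat.choose_mul_succ_eq n k
  linear_combination (a k * f (n - k) x) * e

theorem hasDerivAt_genPoly (φ : ℕ → ℂ) (n : ℕ) (x : ℂ) :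
    HasDerivAt (genPoly φ (n + 1)) (((n : ℂ) + 1) * genPoly φ n x) x := by
  refine appell_conv (fun n u => u ^ n) φ ?_ ?_ n x
  · intro x
    simpa using hasDerivAt_const x (1 : ℂ)
  · intro n x
    simpa using hasDerivAt_pow (n + 1) x

theorem hasDerivAt_Glam (R : ℂ) (φ : ℕ → ℂ) (n : ℕ) (x : ℂ) :
    HasDerivAt (Glam R φ (n + 1)) (((n : ℂ) + 1) * Glam R φ n x) x := by
  have h := appell_conv (genPoly φ) (fun j => (-1) ^ j * cR R j) ?_ (hasDerivAt_genPoly φ) n x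
  · simp only [← mul_assoc] at h
    exact h
  · intro x
    have e : genPoly φ 0 = fun _ => φ 0 := by
      funext u
      simp [genPoly]
    rw [e]
    exact hasDerivAt_const x _

/-- Iterated differential recurrence:
`(d/dx)^j _Glam_n^R(x) = (n!/(n-j)!) · _Glam_{n-j}^R(x)` for `j ≤ n`. -/
theorem iteratedDeriv_Glam (R : ℂ) (hR : 0 < R.re) (φ : ℕ → ℂ) (n j : ℕ) (hjn : j ≤ n) (x : ℂ) :
    iteratedDeriv j (fun u => Glam R φ n u) x =
      ((n.factorial : ℂ) / ((n - j).factorial : ℂ)) * Glam R φ (n - j) x := by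
  induction j generalizing x with
  | zero =>
    have : (n.factorial : ℂ) ≠ 0 := by exact_mod_cast n.factorial_ne_zero
    simp [this]
  | succ j ih =>
    have hj : j ≤ n := by omega
    obtain ⟨m, rfl⟩ := Nat.exists_eq_add_of_le hjn
    have e1 : j + 1 + m - j = m + 1 := by omega
    have e2 : j + 1 + m - (j + 1) = m := by omega
    rw [iteratedDeriv_succ, funext (fun x => ih hj x), e1, e2]
    have h := (hasDerivAt_Glam R φ m x).const_mul
      (((j + 1 + m).factorial : ℂ) / ((m + 1).factorial : ℂ))
    rw [h.deriv, Nat.factorial_succ m]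
    have h1 : (m.factorial : ℂ) ≠ 0 := by exact_mod_cast m.factorial_ne_zero
    have h2 : (m : ℂ) + 1 ≠ 0 := by exact_mod_cast m.succ_ne_zero
    push_cast
    field_simp
end

section
/- For every n ∈ ℕ and x ∈ ℂ, the 2-variable general-λ-matrix polynomial admits the explicit convolution representation _Gλ_n^R(x) = Σ_{j=0}^n (n choose j) λ_j^R(x) φ_{n-j}. -/
/-- The 1-variable λ-matrix polynomials
`λ_n^R(x) = n! Σ_{j=0}^n (-1)^j c_R(j) x^{n-j}/(j!(n-j)!)`. -/
noncomputable def lamPoly (R : ℂ) (n : ℕ) (x : ℂ) : ℂ :=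
  (n.factorial : ℂ) * ∑ j ∈ Finset.range (n + 1),
    (-1) ^ j * cR R j * x ^ (n - j) / ((j.factorial : ℂ) * ((n - j).factorial : ℂ))

/-- Explicit convolution representation:
`_Glam_n^R(x) = Σ_{j=0}^n (n choose j) λ_j^R(x) φ_{n-j}`. -/
theorem Glam_eq_conv (R : ℂ) (hR : 0 < R.re) (φ : ℕ → ℂ) (n : ℕ) (x : ℂ) :
    Glam R φ n x = ∑ j ∈ Finset.range (n + 1), (n.choose j : ℂ) * lamPoly R j x * φ (n - j) := by
  have hf : ∀ m : ℕ, (m.factorial : ℂ) ≠ 0 := fun m => by exact_mod_cast m.factorial_ne_zero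
  simp only [Glam, genPoly, lamPoly, Finset.mul_sum, Finset.sum_mul]
  rw [Finset.sum_sigma', Finset.sum_sigma']
  refine Finset.sum_bij' (fun p _ => ⟨n - p.2, p.1⟩) (fun p _ => ⟨p.2, n - p.1⟩) ?_ ?_ ?_ ?_ ?_
  · rintro ⟨j, k⟩ h
    simp only [Finset.mem_sigma, Finset.mem_range] at h ⊢
    omega
  · rintro ⟨j, k⟩ h
    simp only [Finset.mem_sigma, Finset.mem_range] at h ⊢
    omega
  · rintro ⟨j, k⟩ h
    simp only [Finset.mem_sigma, Finset.mem_range] at h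
    have : n - (n - k) = k := by omega
    simp [this]
  · rintro ⟨j, k⟩ h
    simp only [Finset.mem_sigma, Finset.mem_range] at h
    have : n - (n - j) = j := by omega
    simp [this]
  · rintro ⟨j, k⟩ h
    simp only [Finset.mem_sigma, Finset.mem_range] at h
    obtain ⟨d, rfl⟩ : ∃ d, n = j + k + d := ⟨n - j - k, by omega⟩
    have e1 : j + k + d - j = k + d := by omega
    have e2 : j + k + d - k = j + d := by omega
    have e3 : k + d - k = d := by omega
    have e4 : j + d - j = d := by omega
    have e5 : j + k + d - (j + d) = k := by omega
    simp only [e1, e2, e3, e4, e5]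
    rw [Nat.cast_choose ℂ (show j ≤ j + k + d by omega),
      Nat.cast_choose ℂ (show k ≤ k + d by omega),
      Nat.cast_choose ℂ (show j + d ≤ j + k + d by omega), e1, e3, e5]
    have h1 := hf j
    have h2 := hf k
    have h3 := hf d
    have h4 := hf (k + d)
    have h5 := hf (j + d)
    field_simp
end

section
/- The 2-variable general-λ-matrix polynomials satisfy the implicit summation formula: for all n ∈ ℕ and x, z ∈ ℂ, _Gλ_n^R(x + z) = Σ_{j=0}^n (n choose j) z^j · _Gλ_{n-j}^R(x). -/
/-- binomial convolution -/
noncomputable def bconv (f g : ℕ → ℂ) (n : ℕ) : ℂ :=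
  ∑ j ∈ Finset.range (n + 1), (n.choose j : ℂ) * f j * g (n - j)

noncomputable def egf (f : ℕ → ℂ) : PowerSeries ℂ :=
  PowerSeries.mk fun n => f n / (n.factorial : ℂ)

lemma egf_inj {f g : ℕ → ℂ} (h : egf f = egf g) : f = g := by
  funext n
  have h1 := congrArg (PowerSeries.coeff n) h
  have h2 : (n.factorial : ℂ) ≠ 0 := by exact_mod_cast n.factorial_ne_zero
  simp only [egf, PowerSeries.coeff_mk] at h1
  exact (div_left_inj' h2).1 h1

lemma egf_bconv (f g : ℕ → ℂ) : egf (bconv f g) = egf f * egf g := by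
  ext n
  rw [PowerSeries.coeff_mul, Finset.Nat.sum_antidiagonal_eq_sum_range_succ_mk]
  simp only [egf, PowerSeries.coeff_mk, bconv, Finset.sum_div]
  refine Finset.sum_congr rfl fun j hj => ?_
  have hj' : j ≤ n := Nat.lt_succ_iff.1 (Finset.mem_range.1 hj)
  rw [Nat.cast_choose ℂ hj']
  have h1 : (n.factorial : ℂ) ≠ 0 := by exact_mod_cast n.factorial_ne_zero
  have h2 : (j.factorial : ℂ) ≠ 0 := by exact_mod_cast j.factorial_ne_zero
  have h3 : ((n - j).factorial : ℂ) ≠ 0 := by exact_mod_cast (n - j).factorial_ne_zero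
  field_simp

lemma bconv_pow (x z : ℂ) : (fun n => (x + z) ^ n) = bconv (fun n => x ^ n) (fun n => z ^ n) := by
  funext n
  rw [add_pow]
  exact Finset.sum_congr rfl fun j _ => by ring

lemma Glam_eq_bconv (R : ℂ) (φ : ℕ → ℂ) (x : ℂ) :
    (fun n => Glam R φ n x) =
      bconv (fun j => (-1) ^ j * cR R j) (bconv φ (fun n => x ^ n)) := by
  funext n
  simp only [Glam, bconv, genPoly, mul_assoc]

/-- Implicit summation formula:
`_Glam_n^R(x+z) = Σ_{j=0}^n (n choose j) z^j _Glam_{n-j}^R(x)`. -/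
theorem Glam_add (R : ℂ) (hR : 0 < R.re) (φ : ℕ → ℂ) (n : ℕ) (x z : ℂ) :
    Glam R φ n (x + z) = ∑ j ∈ Finset.range (n + 1), (n.choose j : ℂ) * z ^ j * Glam R φ (n - j) x := by
  have key : (fun n => Glam R φ n (x + z)) =
      bconv (fun n => z ^ n) (fun n => Glam R φ n x) := by
    apply egf_inj
    rw [Glam_eq_bconv, Glam_eq_bconv, bconv_pow]
    simp only [egf_bconv]
    ring
  exact congrFun key n
end

section
/- The 2-variable general-λ-matrix polynomials satisfy the two-index identity: for all r, s ∈ ℕ and x, z ∈ ℂ, _Gλ_{r+s}^R(z) = Σ_{n=0}^r Σ_{j=0}^s (r choose n)(s choose j)(z - x)^{n+j} · _Gλ_{r+s-n-j}^R(x). -/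
open Polynomial in
/-- Umbral functional sending `X ^ n` to `φ n`. -/
noncomputable def umb (φ : ℕ → ℂ) : ℂ[X] →ₗ[ℂ] ℂ :=
  Polynomial.lsum fun n => φ n • (LinearMap.id : ℂ →ₗ[ℂ] ℂ)

open Polynomial in
/-- Umbral functional in two variables. -/
noncomputable def umbTwo (R : ℂ) (φ : ℕ → ℂ) : ℂ[X][X] →ₗ[ℂ] ℂ :=
  Polynomial.lsum fun j => ((-1) ^ j * cR R j) • umb φ

open Polynomial in
lemma umb_monomial (φ : ℕ → ℂ) (c : ℂ) (n : ℕ) : umb φ (c • X ^ n) = c * φ n := by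
  rw [Polynomial.smul_X_eq_monomial]
  simp [umb, Polynomial.lsum_apply, Polynomial.sum_monomial_index, mul_comm]

open Polynomial in
lemma umbTwo_monomial (R : ℂ) (φ : ℕ → ℂ) (p : ℂ[X]) (n : ℕ) :
    umbTwo R φ (monomial n p) = (-1) ^ n * cR R n * umb φ p := by
  simp [umbTwo, Polynomial.lsum_apply, Polynomial.sum_monomial_index]

open Polynomial in
lemma genPoly_eq (φ : ℕ → ℂ) (n : ℕ) (x : ℂ) : genPoly φ n x = umb φ ((X + C x) ^ n) := by
  rw [add_pow, map_sum, genPoly]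
  refine Finset.sum_congr rfl fun k _ => ?_
  have : (X ^ k * C x ^ (n - k) * (n.choose k : ℂ[X])) =
      (x ^ (n - k) * (n.choose k : ℂ)) • X ^ k := by
    rw [Polynomial.smul_eq_C_mul]
    simp
    ring
  rw [this, umb_monomial]
  ring

open Polynomial in
lemma Glam_eq (R : ℂ) (φ : ℕ → ℂ) (n : ℕ) (x : ℂ) :
    Glam R φ n x = umbTwo R φ ((X + C (X + C x)) ^ n) := by
  rw [add_pow, map_sum, Glam]
  refine Finset.sum_congr rfl fun k _ => ?_
  have : (X ^ k * C (X + C x) ^ (n - k) * (n.choose k : ℂ[X][X])) =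
      (n.choose k : ℂ) • monomial k ((X + C x) ^ (n - k)) := by
    rw [← Polynomial.C_mul_X_pow_eq_monomial, Nat.cast_smul_eq_nsmul, nsmul_eq_mul, C_pow]
    ring
  rw [this, map_smul, umbTwo_monomial, genPoly_eq, smul_eq_mul]
  ring

open Polynomial in
lemma umb_expand (r : ℕ) (x z : ℂ) : ((X + C (X + C z)) ^ r : ℂ[X][X]) =
    ∑ n ∈ Finset.range (r + 1),
      ((r.choose n : ℂ) * (z - x) ^ n) • ((X + C (X + C x)) ^ (r - n) : ℂ[X][X]) := by
  have : (X + C (X + C z) : ℂ[X][X]) = C (C (z - x)) + (X + C (X + C x)) := by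
    simp only [C_add, C_sub]
    ring
  rw [this, add_pow]
  refine Finset.sum_congr rfl fun n _ => ?_
  rw [mul_smul, Nat.cast_smul_eq_nsmul, nsmul_eq_mul, Algebra.smul_def]
  simp only [Polynomial.algebraMap_apply, Algebra.algebraMap_self, RingHom.id_apply, C_pow]
  ring

/-- Two-index identity:
`_Glam_{r+s}^R(z) = Σ_{n=0}^r Σ_{j=0}^s (r choose n)(s choose j)(z-x)^{n+j} _Glam_{r+s-n-j}^R(x)`. -/
theorem Glam_two_index (R : ℂ) (hR : 0 < R.re) (φ : ℕ → ℂ) (r s : ℕ) (x z : ℂ) :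
    Glam R φ (r + s) z =
      ∑ n ∈ Finset.range (r + 1), ∑ j ∈ Finset.range (s + 1),
        (r.choose n : ℂ) * (s.choose j : ℂ) * (z - x) ^ (n + j) * Glam R φ (r + s - n - j) x := by
  rw [Glam_eq, pow_add, umb_expand r x z, umb_expand s x z, Finset.sum_mul_sum, map_sum]
  refine Finset.sum_congr rfl fun n hn => ?_
  rw [map_sum]
  refine Finset.sum_congr rfl fun j hj => ?_
  rw [Finset.mem_range] at hn hj
  rw [smul_mul_smul_comm, ← pow_add, map_smul, Glam_eq, smul_eq_mul,
    show r + s - n - j = r - n + (s - j) by omega]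
  ring
end

section
/- The 2-variable general-λ-matrix polynomials satisfy the integral representation: for all n ∈ ℕ and x, z ∈ ℝ, ∫_{x}^{x+z} _Gλ_n^R(u) du = (1/(n+1)) Σ_{j=1}^{n+1} ((n+1) choose j) z^j · _Gλ_{n+1-j}^R(x), where the integral is the interval integral of the ℂ-valued polynomial function _Gλ_n^R restricted to the real line. -/
def IsApp (p : ℕ → ℂ → ℂ) : Prop :=
  (∀ x, HasDerivAt (p 0) 0 x) ∧ ∀ n x, HasDerivAt (p (n + 1)) (((n : ℂ) + 1) * p n x) x

theorem isApp_pow : IsApp (fun n x => x ^ n) := by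
  refine ⟨fun x => ?_, fun n x => ?_⟩
  · simpa using hasDerivAt_const x (1 : ℂ)
  · simpa using hasDerivAt_pow (n + 1) x

theorem isApp_conv (p : ℕ → ℂ → ℂ) (hp : IsApp p) (b : ℕ → ℂ) :
    IsApp (fun n x => ∑ j ∈ Finset.range (n + 1), (n.choose j : ℂ) * b j * p (n - j) x) := by
  refine ⟨fun x => ?_, fun n x => ?_⟩
  · simpa using (hp.1 x).const_mul (b 0)
  · have key : HasDerivAt (fun x => ∑ j ∈ Finset.range (n + 1),
        ((n + 1).choose j : ℂ) * b j * p (n + 1 - j) x)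
        (∑ j ∈ Finset.range (n + 1), ((n : ℂ) + 1) * ((n.choose j : ℂ) * b j * p (n - j) x)) x := by
      refine HasDerivAt.fun_sum fun j hj => ?_
      have hj' : j ≤ n := Nat.lt_succ_iff.mp (Finset.mem_range.mp hj)
      obtain ⟨m, rfl⟩ := Nat.exists_eq_add_of_le hj'
      have e1 : j + m + 1 - j = m + 1 := by omega
      have e2 : j + m - j = m := by omega
      rw [e1, e2]
      have h := (hp.2 m x).const_mul (((j + m + 1).choose j : ℂ) * b j)
      refine h.congr_deriv ?_
      have hc : ((j + m).choose j : ℂ) * ((j : ℂ) + m + 1) = ((j + m + 1).choose j : ℂ) * (m + 1) := by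
        have := Nat.choose_mul_succ_eq (j + m) j
        rw [e1] at this
        exact_mod_cast this
      push_cast
      linear_combination (- b j * p m x) * hc
    have h0 := ((hp.1 x).const_mul (((n + 1).choose (n + 1) : ℂ) * b (n + 1)))
    have := key.add h0
    rw [mul_zero, add_zero, ← Finset.mul_sum] at this
    refine this.congr_of_eventuallyEq (Filter.Eventually.of_forall fun y => ?_)
    simp [Finset.sum_range_succ _ (n + 1)]

theorem isApp_unique (f g : ℕ → ℂ → ℂ) (hf : IsApp f) (hg : IsApp g)
    (h : ∀ n, f n 0 = g n 0) (n : ℕ) (z : ℂ) : f n z = g n z := by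
  have aux : ∀ n, (∀ z, HasDerivAt (fun z => f n z - g n z) 0 z) → ∀ z, f n z = g n z := by
    intro n hd z
    have := is_const_of_deriv_eq_zero (fun z => (hd z).differentiableAt) (fun z => (hd z).deriv) z 0
    simp only [h n, sub_self] at this
    exact sub_eq_zero.mp this
  induction n generalizing z with
  | zero => exact aux 0 (fun z => by simpa using (hf.1 z).fun_sub (hg.1 z)) z
  | succ n ih =>
    exact aux (n + 1) (fun z => by simpa [ih z] using (hf.2 n z).fun_sub (hg.2 n z)) z

theorem isApp_Glam (R : ℂ) (φ : ℕ → ℂ) : IsApp (Glam R φ) := by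
  have h := isApp_conv _ (isApp_conv _ isApp_pow φ) (fun j => (-1) ^ j * cR R j)
  convert h using 3 with n x
  simp only [Glam, genPoly, mul_assoc]

theorem isApp_add (G : ℕ → ℂ → ℂ) (hG : IsApp G) (n : ℕ) (x z : ℂ) :
    G n (x + z) = ∑ j ∈ Finset.range (n + 1), (n.choose j : ℂ) * z ^ j * G (n - j) x := by
  have h1 : IsApp (fun n z => G n (x + z)) :=
    ⟨fun z => (hG.1 (x + z)).comp_const_add x z, fun n z => (hG.2 n (x + z)).comp_const_add x z⟩
  have h2 := isApp_conv _ isApp_pow (fun j => G j x)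
  have h3 := isApp_unique _ _ h1 h2 (fun n => by
    simp only [add_zero]
    rw [Finset.sum_range_succ, Finset.sum_eq_zero]
    · simp
    · intro j hj
      have : n - j ≠ 0 := by have := Finset.mem_range.mp hj; omega
      simp [this]) n z
  rw [h3, ← Finset.sum_range_reflect]
  refine Finset.sum_congr rfl fun j hj => ?_
  have hj' : j ≤ n := Nat.lt_succ_iff.mp (Finset.mem_range.mp hj)
  have e1 : n + 1 - 1 - j = n - j := by omega
  have e2 : n - (n - j) = j := by omega
  rw [e1, e2, Nat.choose_symm hj']
  ring

/-- Integral representation: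
`∫_{x}^{x+z} _Glam_n^R(u) du = (1/(n+1)) Σ_{j=1}^{n+1} ((n+1) choose j) z^j _Glam_{n+1-j}^R(x)`
for real `x, z`. -/
theorem Glam_integral (R : ℂ) (hR : 0 < R.re) (φ : ℕ → ℂ) (n : ℕ) (x z : ℝ) :
    (∫ u in x..(x + z), Glam R φ n (u : ℂ)) =
      (1 / ((n : ℂ) + 1)) * ∑ j ∈ Finset.Icc 1 (n + 1),
        ((n + 1).choose j : ℂ) * (z : ℂ) ^ j * Glam R φ (n + 1 - j) (x : ℂ) := by
  have hG := isApp_Glam R φ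
  have hn : ((n : ℂ) + 1) ≠ 0 := by exact_mod_cast Nat.succ_ne_zero n
  have hcont : Continuous (fun u : ℝ => Glam R φ n (u : ℂ)) := by
    unfold Glam genPoly
    fun_prop
  have hint : (∫ u in x..(x + z), Glam R φ n (u : ℂ)) =
      (1 / ((n : ℂ) + 1)) * Glam R φ (n + 1) ((x + z : ℝ) : ℂ)
        - (1 / ((n : ℂ) + 1)) * Glam R φ (n + 1) (x : ℂ) := by
    refine intervalIntegral.integral_eq_sub_of_hasDerivAt
      (f := fun u : ℝ => (1 / ((n : ℂ) + 1)) * Glam R φ (n + 1) (u : ℂ))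
      (fun u _ => ?_) (hcont.intervalIntegrable _ _)
    refine (((hG.2 n (u : ℂ)).comp_ofReal).const_mul (1 / ((n : ℂ) + 1))).congr_deriv ?_
    field_simp
  rw [hint, ← mul_sub, Complex.ofReal_add, isApp_add _ hG (n + 1) x z,
    Finset.range_eq_Ico, Finset.sum_eq_sum_Ico_succ_bot (by omega)]
  have : Finset.Ico (0 + 1) (n + 1 + 1) = Finset.Icc 1 (n + 1) := by
    ext; simp <;> omega
  rw [this]
  simp
end

section
/- For every n ∈ ℕ and x ∈ ℂ, the binomial convolution of the 2-variable general-λ-matrix polynomials with the inverse sequence γ recovers the 1-variable λ-matrix polynomial: Σ_{j=0}^n (n choose j) γ_j · _Gλ_{n-j}^R(x) = λ_n^R(x). -/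
/-- Exponential generating series. -/
noncomputable def egs (f : ℕ → ℂ) : PowerSeries ℂ := PowerSeries.mk fun n => f n / (n.factorial : ℂ)

theorem choose_div_fact (n j : ℕ) (h : j ≤ n) :
    (n.choose j : ℂ) / (n.factorial : ℂ) = 1 / ((j.factorial : ℂ) * ((n - j).factorial : ℂ)) := by
  rw [Nat.cast_choose ℂ h]
  have h1 : (n.factorial : ℂ) ≠ 0 := by exact_mod_cast n.factorial_ne_zero
  field_simp

theorem egs_mul (f g : ℕ → ℂ) : egs f * egs g =
    egs (fun n => ∑ j ∈ Finset.range (n + 1), (n.choose j : ℂ) * f j * g (n - j)) := by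
  ext n
  simp only [egs, PowerSeries.coeff_mul, PowerSeries.coeff_mk]
  rw [Finset.Nat.sum_antidiagonal_eq_sum_range_succ
    (fun i j => f i / (i.factorial : ℂ) * (g j / (j.factorial : ℂ))), Finset.sum_div]
  refine Finset.sum_congr rfl fun j hj => ?_
  have h := choose_div_fact n j (by have := Finset.mem_range.1 hj; omega)
  calc _ = (1 / ((j.factorial : ℂ) * ((n - j).factorial : ℂ))) * f j * g (n - j) := by
        rw [div_mul_div_comm]; ring
    _ = _ := by rw [← h]; ring

theorem egs_inv (φ : ℕ → ℂ) (hφ : φ 0 ≠ 0) (γ : ℕ → ℂ)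
    (hγ0 : γ 0 = 1 / φ 0)
    (hγ : ∀ n, 1 ≤ n →
      γ n = -(1 / φ 0) * ∑ j ∈ Finset.Icc 1 n, (n.choose j : ℂ) * φ j * γ (n - j)) :
    egs φ * egs γ = 1 := by
  rw [egs_mul]
  ext n
  simp only [egs, PowerSeries.coeff_mk, PowerSeries.coeff_one]
  rcases Nat.eq_zero_or_pos n with rfl | hn
  · simp [hγ0, hφ]
  · have h2 : Finset.range (n + 1) = insert 0 (Finset.Icc 1 n) := by
      ext k; simp only [Finset.mem_range, Finset.mem_insert, Finset.mem_Icc]; omega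
    rw [if_neg (by omega), h2, Finset.sum_insert (by simp)]
    have h3 := hγ n hn
    set S := ∑ j ∈ Finset.Icc 1 n, (n.choose j : ℂ) * φ j * γ (n - j)
    simp only [Nat.choose_zero_right, Nat.sub_zero, h3]
    field_simp
    simp

/-- Binomial convolution with γ recovers the 1-variable λ-matrix polynomial:
`Σ_{j=0}^n (n choose j) γ_j _Glam_{n-j}^R(x) = λ_n^R(x)`. -/
theorem conv_gamma_Glam (R : ℂ) (hR : 0 < R.re) (φ : ℕ → ℂ) (hφ : φ 0 ≠ 0) (γ : ℕ → ℂ)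
    (hγ0 : γ 0 = 1 / φ 0)
    (hγ : ∀ n, 1 ≤ n →
      γ n = -(1 / φ 0) * ∑ j ∈ Finset.Icc 1 n, (n.choose j : ℂ) * φ j * γ (n - j))
    (n : ℕ) (x : ℂ) :
    (∑ j ∈ Finset.range (n + 1), (n.choose j : ℂ) * γ j * Glam R φ (n - j) x) =
      lamPoly R n x := by
  have hp : egs (fun n => genPoly φ n x) = egs φ * egs (fun n => x ^ n) := by
    rw [egs_mul]; rfl
  have hG : egs (fun n => Glam R φ n x) =
      egs (fun j => (-1) ^ j * cR R j) * egs (fun n => genPoly φ n x) := by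
    rw [egs_mul]; simp only [Glam, mul_assoc]
  have hl : egs (fun n => lamPoly R n x) =
      egs (fun j => (-1) ^ j * cR R j) * egs (fun n => x ^ n) := by
    rw [egs_mul]
    congr 1
    funext n
    rw [lamPoly, Finset.mul_sum]
    refine Finset.sum_congr rfl fun j hj => ?_
    rw [Nat.cast_choose ℂ (by have := Finset.mem_range.1 hj; omega : j ≤ n)]
    ring
  have key : egs γ * egs (fun n => Glam R φ n x) = egs (fun n => lamPoly R n x) := by
    rw [hG, hp, hl]
    linear_combination (egs (fun j => (-1) ^ j * cR R j) * egs (fun n => x ^ n)) *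
      egs_inv φ hφ γ hγ0 hγ
  rw [egs_mul] at key
  have h := congrArg (PowerSeries.coeff n) key
  simp only [egs, PowerSeries.coeff_mk] at h
  have h1 : (n.factorial : ℂ) ≠ 0 := by exact_mod_cast n.factorial_ne_zero
  exact (div_left_inj' h1).1 h
end

section
/- The exponential generating function of the Gould–Hopper-λ-matrix polynomials factorizes as e^{xt}·e^{yt^m}·cos(√t;R): in ℂ[[t]], (Σ_{n≥0} (_{H^m}λ_n^R(x,y)/n!) t^n) = (Σ_{n≥0} (x^n/n!) t^n) · (Σ_{k≥0} (y^k/k!) t^{mk}) · (Σ_{j≥0} (-1)^j c_R(j) t^j/j!). -/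
/-- The Gould–Hopper polynomials `H_n^{(m)}(x,y) = n! Σ_{j=0}^{⌊n/m⌋} y^j x^{n-mj}/(j!(n-mj)!)`. -/
noncomputable def gouldHopper (m n : ℕ) (x y : ℂ) : ℂ :=
  (n.factorial : ℂ) * ∑ j ∈ Finset.range (n / m + 1),
    y ^ j * x ^ (n - m * j) / ((j.factorial : ℂ) * ((n - m * j).factorial : ℂ))

/-- The Gould–Hopper-λ-matrix polynomials
`_{H^m}λ_n^R(x,y) = Σ_{j=0}^n (n choose j) (-1)^j c_R(j) H_{n-j}^{(m)}(x,y)`. -/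
noncomputable def GHlam (R : ℂ) (m n : ℕ) (x y : ℂ) : ℂ :=
  ∑ j ∈ Finset.range (n + 1), (n.choose j : ℂ) * (-1) ^ j * cR R j * gouldHopper m (n - j) x y

theorem gouldHopper_coeff (m : ℕ) (hm : 1 ≤ m) (x y : ℂ) (n : ℕ) :
    gouldHopper m n x y / (n.factorial : ℂ) =
      PowerSeries.coeff n (PowerSeries.mk (fun n => x ^ n / (n.factorial : ℂ)) *
        PowerSeries.mk (fun n => if m ∣ n then y ^ (n / m) / ((n / m).factorial : ℂ) else 0)) := by
  have hn : (n.factorial : ℂ) ≠ 0 := by exact_mod_cast n.factorial_ne_zero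
  rw [mul_comm, PowerSeries.coeff_mul, Finset.Nat.sum_antidiagonal_eq_sum_range_succ_mk]
  simp only [PowerSeries.coeff_mk, ite_mul, zero_mul]
  rw [gouldHopper, mul_div_cancel_left₀ _ hn, ← Finset.sum_filter]
  refine Finset.sum_bij (fun j _ => m * j) ?_ ?_ ?_ ?_
  · intro j hj
    simp only [Finset.mem_range, Finset.mem_filter] at hj ⊢
    have h1 : j ≤ n / m := by omega
    have h2 := (Nat.le_div_iff_mul_le hm).1 h1
    rw [mul_comm] at h2
    exact ⟨by omega, dvd_mul_right _ _⟩
  · intro a _ b _ h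
    exact Nat.eq_of_mul_eq_mul_left hm h
  · intro b hb
    simp only [Finset.mem_range, Finset.mem_filter] at hb
    obtain ⟨h1, k, rfl⟩ := hb
    refine ⟨k, ?_, rfl⟩
    have : k ≤ n / m := (Nat.le_div_iff_mul_le hm).2 (by rw [mul_comm]; omega)
    simp only [Finset.mem_range]
    omega
  · intro j _
    rw [Nat.mul_div_cancel_left j hm, div_mul_div_comm]

/-- The exponential generating function of the Gould–Hopper-λ-matrix polynomials factorizes
as `e^{xt} · e^{yt^m} · cos(√t; R)` in `ℂ[[t]]`; the middle factor `Σ_k (y^k/k!) t^{mk}` is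
the series whose `n`-th coefficient is `y^{n/m}/(n/m)!` if `m ∣ n` and 0 otherwise. -/
theorem egf_GHlam (R : ℂ) (hR : 0 < R.re) (m : ℕ) (hm : 1 ≤ m) (x y : ℂ) :
    PowerSeries.mk (fun n => GHlam R m n x y / (n.factorial : ℂ)) =
      PowerSeries.mk (fun n => x ^ n / (n.factorial : ℂ)) *
        PowerSeries.mk (fun n => if m ∣ n then y ^ (n / m) / ((n / m).factorial : ℂ) else 0) *
        PowerSeries.mk (fun j => (-1) ^ j * cR R j / (j.factorial : ℂ)) := by
  ext n
  have hn : (n.factorial : ℂ) ≠ 0 := by exact_mod_cast n.factorial_ne_zero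
  rw [mul_comm, PowerSeries.coeff_mul, Finset.Nat.sum_antidiagonal_eq_sum_range_succ_mk]
  simp only [← gouldHopper_coeff m hm x y]
  simp only [PowerSeries.coeff_mk]
  rw [GHlam, Finset.sum_div]
  refine Finset.sum_congr rfl fun j hj => ?_
  have hj' : j ≤ n := by
    simp only [Finset.mem_range] at hj
    omega
  have h1 : (j.factorial : ℂ) ≠ 0 := by exact_mod_cast j.factorial_ne_zero
  have h2 : ((n - j).factorial : ℂ) ≠ 0 := by exact_mod_cast (n - j).factorial_ne_zero
  rw [Nat.cast_choose ℂ hj']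
  field_simp
end

section
/- For every n ≥ 1 and x, y ∈ ℂ, the Gould–Hopper-λ-matrix polynomial satisfies the recurrence (∂/∂x) _{H^m}λ_n^R(x,y) = n · _{H^m}λ_{n-1}^R(x,y), where the derivative is taken in the complex variable x with y fixed. -/
theorem gouldHopper_eq (m : ℕ) (hm : 1 ≤ m) (n N : ℕ) (hN : n + 1 ≤ N) (x y : ℂ) :
    gouldHopper m n x y = (n.factorial : ℂ) * ∑ j ∈ Finset.range N,
      if m * j ≤ n then
        y ^ j * x ^ (n - m * j) / ((j.factorial : ℂ) * ((n - m * j).factorial : ℂ)) else 0 := by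
  unfold gouldHopper
  congr 1
  rw [← Finset.sum_filter]
  apply Finset.sum_congr _ (fun _ _ => rfl)
  ext j
  simp only [Finset.mem_range, Finset.mem_filter]
  rw [Nat.lt_succ_iff, Nat.le_div_iff_mul_le hm, mul_comm j m]
  constructor
  · intro h
    refine ⟨?_, h⟩
    nlinarith
  · exact fun h => h.2

theorem hasDerivAt_gouldHopper (m : ℕ) (hm : 1 ≤ m) (n : ℕ) (x y : ℂ) :
    HasDerivAt (fun u => gouldHopper m (n + 1) u y) (((n : ℂ) + 1) * gouldHopper m n x y) x := by
  have e : (fun u => gouldHopper m (n + 1) u y) = fun u => _ :=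
    funext fun u => gouldHopper_eq m hm (n + 1) (n + 2) le_rfl u y
  rw [e, gouldHopper_eq m hm n (n + 2) (by omega), ← mul_assoc,
    show ((n : ℂ) + 1) * (n.factorial : ℂ) = ((n + 1).factorial : ℂ) by
      rw [Nat.factorial_succ]; push_cast; ring]
  apply HasDerivAt.const_mul
  apply HasDerivAt.fun_sum
  intro j _
  by_cases h : m * j ≤ n
  · have h' : m * j ≤ n + 1 := by omega
    simp only [h, h', if_true]
    obtain ⟨k, hk⟩ := Nat.exists_eq_add_of_le h
    have h1 : n + 1 - m * j = k + 1 := by omega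
    have h2 : n - m * j = k := by omega
    rw [h1, h2]
    have := (((hasDerivAt_pow (k + 1) x).const_mul (y ^ j)).div_const
      ((j.factorial : ℂ) * ((k + 1).factorial : ℂ)))
    refine this.congr_deriv (Eq.symm ?_)
    have a : (j.factorial : ℂ) ≠ 0 := by exact_mod_cast j.factorial_ne_zero
    have b : (k.factorial : ℂ) ≠ 0 := by exact_mod_cast k.factorial_ne_zero
    have c : (k : ℂ) + 1 ≠ 0 := by exact_mod_cast k.succ_ne_zero
    rw [Nat.factorial_succ]
    push_cast
    field_simp
  · simp only [h, if_false]
    by_cases h' : m * j ≤ n + 1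
    · have h1 : n + 1 - m * j = 0 := by omega
      simp only [h', if_true, h1, pow_zero]
      exact hasDerivAt_const _ _
    · simp only [h', if_false]
      exact hasDerivAt_const _ _

theorem hasDerivAt_GHlam (R : ℂ) (m : ℕ) (hm : 1 ≤ m) (n : ℕ) (x y : ℂ) :
    HasDerivAt (fun u => GHlam R m (n + 1) u y) (((n : ℂ) + 1) * GHlam R m n x y) x := by
  unfold GHlam
  simp only [Finset.sum_range_succ _ (n + 1), Nat.sub_self]
  rw [← add_zero (((n : ℂ) + 1) * _)]
  apply HasDerivAt.add
  · rw [Finset.mul_sum]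
    apply HasDerivAt.fun_sum
    intro j hj
    obtain ⟨k, rfl⟩ := Nat.exists_eq_add_of_le (Nat.lt_succ_iff.mp (Finset.mem_range.mp hj))
    have h1 : j + k + 1 - j = k + 1 := by omega
    have h2 : j + k - j = k := by omega
    rw [h1, h2]
    have := (hasDerivAt_gouldHopper m hm k x y).const_mul
      (((j + k + 1).choose j : ℂ) * (-1) ^ j * cR R j)
    refine this.congr_deriv (Eq.symm ?_)
    have e : ((j + k).choose j : ℂ) * ((j + k : ℕ) + 1) = ((j + k + 1).choose j : ℂ) * (k + 1) := by
      have := Nat.choose_mul_succ_eq (j + k) j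
      rw [h1] at this
      exact_mod_cast this
    linear_combination ((-1) ^ j * cR R j * gouldHopper m k x y) * e
  · simp only [gouldHopper, Nat.zero_div, Nat.zero_sub, pow_zero]
    exact hasDerivAt_const _ _

/-- Differential recurrence for the Gould–Hopper-λ-matrix polynomials:
`(∂/∂x) _{H^m}λ_n^R(x,y) = n · _{H^m}λ_{n-1}^R(x,y)` for `n ≥ 1`. -/
theorem deriv_GHlam (R : ℂ) (hR : 0 < R.re) (m : ℕ) (hm : 1 ≤ m) (n : ℕ) (hn : 1 ≤ n)
    (x y : ℂ) :
    deriv (fun u => GHlam R m n u y) x = (n : ℂ) * GHlam R m (n - 1) x y := by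
  obtain ⟨k, rfl⟩ := Nat.exists_eq_add_of_le' hn
  rw [(hasDerivAt_GHlam R m hm k x y).deriv]
  simp
end

section
/- The exponential generating function of the generalized Laguerre-λ-matrix polynomials factorizes as e^{xt}·C_0(−yt^m)·cos(√t;R): in ℂ[[t]], (Σ_{n≥0} (_{mL}λ_n^R(y,x)/n!) t^n) = (Σ_{n≥0} (x^n/n!) t^n) · (Σ_{k≥0} (y^k/(k!)^2) t^{mk}) · (Σ_{j≥0} (-1)^j c_R(j) t^j/j!). -/
/-- The generalized Laguerre polynomials
`_mL_n(y,x) = n! Σ_{j=0}^{⌊n/m⌋} y^j x^{n-mj}/((j!)^2 (n-mj)!)`. -/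
noncomputable def genLaguerre (m n : ℕ) (y x : ℂ) : ℂ :=
  (n.factorial : ℂ) * ∑ j ∈ Finset.range (n / m + 1),
    y ^ j * x ^ (n - m * j) / (((j.factorial : ℂ)) ^ 2 * ((n - m * j).factorial : ℂ))

/-- The generalized Laguerre-λ-matrix polynomials
`_{mL}λ_n^R(y,x) = Σ_{j=0}^n (n choose j) (-1)^j c_R(j) _mL_{n-j}(y,x)`. -/
noncomputable def Llam (R : ℂ) (m n : ℕ) (y x : ℂ) : ℂ :=
  ∑ j ∈ Finset.range (n + 1), (n.choose j : ℂ) * (-1) ^ j * cR R j * genLaguerre m (n - j) y x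

theorem genLaguerre_coeff (m : ℕ) (hm : 1 ≤ m) (x y : ℂ) (n : ℕ) :
    PowerSeries.coeff n (PowerSeries.mk (fun n => x ^ n / (n.factorial : ℂ)) *
        PowerSeries.mk (fun n =>
          if m ∣ n then y ^ (n / m) / (((n / m).factorial : ℂ)) ^ 2 else 0)) =
      genLaguerre m n y x / (n.factorial : ℂ) := by
  have hn : (n.factorial : ℂ) ≠ 0 := by exact_mod_cast n.factorial_ne_zero
  rw [mul_comm, PowerSeries.coeff_mul, Finset.Nat.sum_antidiagonal_eq_sum_range_succ_mk,
    genLaguerre, mul_div_cancel_left₀ _ hn]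
  simp only [PowerSeries.coeff_mk, ite_mul, zero_mul]
  rw [← Finset.sum_filter]
  symm
  refine Finset.sum_nbij (fun j => m * j) ?_ ?_ ?_ ?_
  · intro j hj
    have h1 : j ≤ n / m := by simpa [Nat.lt_succ_iff] using hj
    have h2 := (Nat.le_div_iff_mul_le hm).1 h1
    simp only [Finset.mem_filter, Finset.mem_range]
    exact ⟨by rw [mul_comm]; omega, dvd_mul_right _ _⟩
  · intro a _ b _ h
    exact Nat.eq_of_mul_eq_mul_left hm h
  · intro k hk
    simp only [Finset.coe_filter, Finset.mem_range, Set.mem_setOf_eq] at hk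
    obtain ⟨hk, j, rfl⟩ := hk
    refine ⟨j, ?_, rfl⟩
    have : j ≤ n / m := (Nat.le_div_iff_mul_le hm).2 (by rw [mul_comm]; omega)
    simp only [Finset.coe_range, Set.mem_Iio]
    omega
  · intro j _
    simp only [Nat.mul_div_cancel_left j hm]
    rw [div_mul_div_comm]

/-- The exponential generating function of the generalized Laguerre-λ-matrix polynomials
factorizes as `e^{xt} · C_0(−yt^m) · cos(√t; R)` in `ℂ[[t]]`; the middle factor
`Σ_k (y^k/(k!)^2) t^{mk}` is the series whose `n`-th coefficient is `y^{n/m}/((n/m)!)^2`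
if `m ∣ n` and 0 otherwise. -/
theorem egf_Llam (R : ℂ) (hR : 0 < R.re) (m : ℕ) (hm : 1 ≤ m) (x y : ℂ) :
    PowerSeries.mk (fun n => Llam R m n y x / (n.factorial : ℂ)) =
      PowerSeries.mk (fun n => x ^ n / (n.factorial : ℂ)) *
        PowerSeries.mk (fun n =>
          if m ∣ n then y ^ (n / m) / (((n / m).factorial : ℂ)) ^ 2 else 0) *
        PowerSeries.mk (fun j => (-1) ^ j * cR R j / (j.factorial : ℂ)) := by
  ext n
  have hn : (n.factorial : ℂ) ≠ 0 := by exact_mod_cast n.factorial_ne_zero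
  rw [mul_comm, PowerSeries.coeff_mul, Finset.Nat.sum_antidiagonal_eq_sum_range_succ_mk]
  simp only [genLaguerre_coeff m hm, PowerSeries.coeff_mk]
  rw [Llam, Finset.sum_div]
  refine Finset.sum_congr rfl fun j hj => ?_
  have hj : j ≤ n := by simpa [Nat.lt_succ_iff] using hj
  have h1 : (j.factorial : ℂ) ≠ 0 := by exact_mod_cast j.factorial_ne_zero
  have h2 : ((n - j).factorial : ℂ) ≠ 0 := by exact_mod_cast (n - j).factorial_ne_zero
  rw [Nat.cast_choose ℂ hj]
  field_simp
end

section
/- For every n ≥ 1 and x, y ∈ ℂ, the generalized Laguerre-λ-matrix polynomial satisfies the recurrence (∂/∂x) _{mL}λ_n^R(y,x) = n · _{mL}λ_{n-1}^R(y,x), where the derivative is taken in the complex variable x with y fixed. -/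
noncomputable def auxT (m n j : ℕ) (y x : ℂ) : ℂ :=
  if m * j ≤ n then
    y ^ j * x ^ (n - m * j) / (((j.factorial : ℂ)) ^ 2 * ((n - m * j).factorial : ℂ)) else 0

lemma genLaguerre_eq_aux (m n N : ℕ) (hm : 1 ≤ m) (hN : n + 1 ≤ N) (y x : ℂ) :
    genLaguerre m n y x = (n.factorial : ℂ) * ∑ j ∈ Finset.range N, auxT m n j y x := by
  unfold genLaguerre
  congr 1
  have hsub : Finset.range (n / m + 1) ⊆ Finset.range N := by
    intro j hj
    have := Nat.div_le_self n m
    simp only [Finset.mem_range] at *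
    omega
  rw [← Finset.sum_subset hsub]
  · refine Finset.sum_congr rfl fun j hj => ?_
    have hj' : j ≤ n / m := by simp only [Finset.mem_range] at hj; omega
    have : m * j ≤ n := by
      rw [mul_comm]; exact (Nat.le_div_iff_mul_le hm).1 hj'
    simp [auxT, this]
  · intro j _ hj
    have hj' : n / m < j := by simp only [Finset.mem_range] at hj; omega
    have : ¬ m * j ≤ n := by
      rw [mul_comm, ← Nat.le_div_iff_mul_le hm]; omega
    simp [auxT, this]

lemma hasDerivAt_auxT (m k j : ℕ) (y x : ℂ) :
    HasDerivAt (fun u => auxT m (k + 1) j y u) (auxT m k j y x) x := by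
  by_cases h : m * j ≤ k
  · have h1 : m * j ≤ k + 1 := by omega
    have h2 : k + 1 - m * j = (k - m * j) + 1 := by omega
    simp only [auxT, h, h1, if_true, h2]
    have := (((hasDerivAt_pow (k - m * j + 1) x).const_mul (y ^ j)).div_const
      (((j.factorial : ℂ)) ^ 2 * ((k - m * j + 1).factorial : ℂ)))
    refine this.congr_deriv (Eq.symm ?_)
    have a : (j.factorial : ℂ) ≠ 0 := by exact_mod_cast j.factorial_ne_zero
    have b : ((k - m * j).factorial : ℂ) ≠ 0 := by exact_mod_cast Nat.factorial_ne_zero _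
    have c : (((k - m * j : ℕ) : ℂ) + 1) ≠ 0 := Nat.cast_add_one_ne_zero _
    rw [Nat.factorial_succ, Nat.add_sub_cancel]
    generalize k - m * j = p at *
    push_cast
    field_simp
  · simp only [auxT, h, if_false]
    by_cases h1 : m * j ≤ k + 1
    · have h2 : k + 1 - m * j = 0 := by omega
      simp only [h1, if_true, h2, pow_zero]
      exact hasDerivAt_const _ _
    · simp only [h1, if_false]
      exact hasDerivAt_const _ _

lemma hasDerivAt_genLaguerre (m k : ℕ) (hm : 1 ≤ m) (y x : ℂ) :
    HasDerivAt (fun u => genLaguerre m (k + 1) y u) (((k : ℂ) + 1) * genLaguerre m k y x) x := by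
  have e : (fun u => genLaguerre m (k + 1) y u) = fun u => ((k + 1).factorial : ℂ) *
      ∑ j ∈ Finset.range (k + 2), auxT m (k + 1) j y u := by
    funext u; exact genLaguerre_eq_aux m (k + 1) (k + 2) hm (by omega) y u
  rw [e, genLaguerre_eq_aux m k (k + 2) hm (by omega)]
  have := (HasDerivAt.fun_sum (u := Finset.range (k + 2)) fun j _ =>
    hasDerivAt_auxT m k j y x).const_mul ((k + 1).factorial : ℂ)
  refine this.congr_deriv (Eq.symm ?_)
  rw [Nat.factorial_succ]; push_cast; ring

lemma genLaguerre_zero_aux (m : ℕ) (y x : ℂ) : genLaguerre m 0 y x = 1 := by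
  simp [genLaguerre]

/-- Differential recurrence for the generalized Laguerre-λ-matrix polynomials:
`(∂/∂x) _{mL}λ_n^R(y,x) = n · _{mL}λ_{n-1}^R(y,x)` for `n ≥ 1`. -/
theorem deriv_Llam (R : ℂ) (hR : 0 < R.re) (m : ℕ) (hm : 1 ≤ m) (n : ℕ) (hn : 1 ≤ n)
    (x y : ℂ) :
    deriv (fun u => Llam R m n y u) x = (n : ℂ) * Llam R m (n - 1) y x := by
  obtain ⟨k, rfl⟩ : ∃ k, n = k + 1 := ⟨n - 1, by omega⟩
  apply HasDerivAt.deriv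
  have e : (fun u => Llam R m (k + 1) y u) = fun u =>
      ∑ j ∈ Finset.range (k + 1), ((k + 1).choose j : ℂ) * (-1) ^ j * cR R j *
        genLaguerre m (k - j + 1) y u
      + ((k + 1).choose (k + 1) : ℂ) * (-1) ^ (k + 1) * cR R (k + 1) := by
    funext u
    unfold Llam
    rw [Finset.sum_range_succ]
    congr 1
    · refine Finset.sum_congr rfl fun j hj => ?_
      have : k + 1 - j = k - j + 1 := by simp only [Finset.mem_range] at hj; omega
      rw [this]
    · rw [Nat.sub_self, genLaguerre_zero_aux, mul_one]
  rw [e]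
  have := (HasDerivAt.fun_sum (u := Finset.range (k + 1)) fun j _ =>
    (hasDerivAt_genLaguerre m (k - j) hm y x).const_mul
      (((k + 1).choose j : ℂ) * (-1) ^ j * cR R j)).add_const
      (((k + 1).choose (k + 1) : ℂ) * (-1) ^ (k + 1) * cR R (k + 1))
  refine this.congr_deriv (Eq.symm ?_)
  unfold Llam
  rw [Nat.add_sub_cancel, Finset.mul_sum]
  refine Finset.sum_congr rfl fun j hj => ?_
  have hj' : j ≤ k := by simp only [Finset.mem_range] at hj; omega
  have hc : ((k : ℂ) + 1) * (k.choose j : ℂ) = ((k + 1).choose j : ℂ) * (((k - j : ℕ) : ℂ) + 1) := by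
    have h := Nat.add_one_mul_choose_eq k (k - j)
    rw [Nat.choose_symm hj'] at h
    have h3 : (k.succ).choose (k - j).succ = (k + 1).choose j := by
      rw [← Nat.choose_symm (by omega : j ≤ k + 1)]
      congr 1; omega
    rw [h3] at h
    exact_mod_cast h
  push_cast
  linear_combination ((-1) ^ j * cR R j * genLaguerre m (k - j) y x) * hc
end
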